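/- (Reduction to orthogonal bigrassmannians) Assume W is finite. If (w, i, j) ∈ Γ(W) with w bigrassmannian, then there exists (v, r, s) ∈ Γ(W) such that v is bigrassmannian, v satisfies the orthogonality condition, and (w, i, j) ↔ (v, r, s). -/

import Mathlib

open CoxeterSystem

namespace NilpotencyIndices

variable {B : Type*} {W : Type*} [Group W] {M : CoxeterMatrix B}

/-- The set `Γ(W)` of triples `(w, i, j)` with `ℓ(sᵢ w sⱼ) = ℓ(w) - 2`
(stated as `ℓ(sᵢ w sⱼ) + 2 = ℓ(w)` to avoid truncated subtraction). -/
def InGamma (cs : CoxeterSystem M W) (x : W × B × B) : Prop :=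
  cs.length (cs.simple x.2.1 * x.1 * cs.simple x.2.2) + 2 = cs.length x.1

/-- The weak left (Bruhat) order: `v ≤_L w` iff `ℓ(v) + ℓ(w v⁻¹) = ℓ(w)`. -/
def WeakLeftLE (cs : CoxeterSystem M W) (v w : W) : Prop :=
  cs.length v + cs.length (w * v⁻¹) = cs.length w

/-- The weak right (Bruhat) order: `v ≤_R w` iff `ℓ(v) + ℓ(v⁻¹ w) = ℓ(w)`. -/
def WeakRightLE (cs : CoxeterSystem M W) (v w : W) : Prop :=
  cs.length v + cs.length (v⁻¹ * w) = cs.length w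

/-- `v(α_a) = α_b`: the group-theoretic condition `v sₐ v⁻¹ = s_b` and `ℓ(v sₐ) = ℓ(v) + 1`. -/
def MapsSimple (cs : CoxeterSystem M W) (v : W) (a b : B) : Prop :=
  v * cs.simple a * v⁻¹ = cs.simple b ∧ cs.length (v * cs.simple a) = cs.length v + 1

/-- `(w, i, j) →_L (u, i', j')` iff both triples are in `Γ(W)`, `u ≤_L w`, `j' = j`, and
`(w u⁻¹)(α_{i'}) = α_i`. -/
def RedL (cs : CoxeterSystem M W) (x y : W × B × B) : Prop :=
  InGamma cs x ∧ InGamma cs y ∧ WeakLeftLE cs y.1 x.1 ∧ y.2.2 = x.2.2 ∧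
    MapsSimple cs (x.1 * y.1⁻¹) y.2.1 x.2.1

/-- `(w, i, j) →_R (u, i', j')` iff both triples are in `Γ(W)`, `u ≤_R w`, `i' = i`, and
`(u⁻¹ w)(α_j) = α_{j'}`. -/
def RedR (cs : CoxeterSystem M W) (x y : W × B × B) : Prop :=
  InGamma cs x ∧ InGamma cs y ∧ WeakRightLE cs y.1 x.1 ∧ y.2.1 = x.2.1 ∧
    MapsSimple cs (y.1⁻¹ * x.1) x.2.2 y.2.2

/-- `→`: the reflexive-transitive closure of the union of `→_L` and `→_R`. -/
def Red (cs : CoxeterSystem M W) : (W × B × B) → (W × B × B) → Prop :=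
  Relation.ReflTransGen (fun x y => RedL cs x y ∨ RedR cs x y)

/-- `↔`: the equivalence relation generated by `→`. -/
def EquivRed (cs : CoxeterSystem M W) : (W × B × B) → (W × B × B) → Prop :=
  Relation.EqvGen (Red cs)

/-- The alternating word `a, b, a, b, …` with `n` letters, starting with `a`. -/
def altWord (a b : B) : ℕ → List B
  | 0 => []
  | n + 1 => a :: altWord b a n

/-- `w₀(a, b)`: the alternating product `sₐ s_b sₐ ⋯` with `M a b` factors, the longest element
of the subgroup generated by `sₐ` and `s_b` when `M a b` is finite (i.e. nonzero). -/
def w0 (cs : CoxeterSystem M W) (a b : B) : W :=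
  cs.wordProd (altWord a b (M a b))

/-- An element is bigrassmannian if it has exactly one left descent and exactly one
right descent. -/
def Bigrassmannian (cs : CoxeterSystem M W) (w : W) : Prop :=
  (∃! i, cs.IsLeftDescent w i) ∧ (∃! j, cs.IsRightDescent w j)

/-- The support of `w`: the set of indices appearing in some reduced word for `w`. -/
def Supp (cs : CoxeterSystem M W) (w : W) : Set B :=
  {i | ∃ l : List B, cs.IsReduced l ∧ cs.wordProd l = w ∧ i ∈ l}

/-- The relation `(w, i, j) →_{(k,L)} (u, i', j')`. -/
def RedkL (cs : CoxeterSystem M W) (k : B) (x y : W × B × B) : Prop :=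
  cs.length y.1 < cs.length x.1 ∧ RedR cs (x.1 * cs.simple k, x.2.1, x.2.2) x ∧
    RedL cs (x.1 * cs.simple k, x.2.1, x.2.2) y ∧ WeakLeftLE cs y.1 x.1

/-- The relation `(w, i, j) →_{(k,R)} (u, i', j')`. -/
def RedkR (cs : CoxeterSystem M W) (k : B) (x y : W × B × B) : Prop :=
  cs.length y.1 < cs.length x.1 ∧ RedL cs (cs.simple k * x.1, x.2.1, x.2.2) x ∧
    RedR cs (cs.simple k * x.1, x.2.1, x.2.2) y ∧ WeakRightLE cs y.1 x.1

/-- The orthogonality condition for a bigrassmannian element `w` with `D_L(w) = {i}` and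
`D_R(w) = {j}`. -/
def OrthCond (cs : CoxeterSystem M W) (w : W) (i j : B) : Prop :=
  (∀ a b : B, M a j = 2 → MapsSimple cs w a b → M b i = 2) ∧
  (∀ a b : B, M a i = 2 → MapsSimple cs w⁻¹ a b → M b j = 2)

/-- The functional `v ↦ 2⟨α_i, v⟩` of the geometric representation. -/
noncomputable def corootForm (M : CoxeterMatrix B) (i : B) : (B →₀ ℝ) →ₗ[ℝ] ℝ :=
  Finsupp.linearCombination ℝ fun j => -2 * Real.cos (Real.pi / M i j)

theorem corootForm_single (M : CoxeterMatrix B) (i j : B) :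
    corootForm M i (Finsupp.single j 1) = -2 * Real.cos (Real.pi / M i j) := by
  simp [corootForm]

theorem corootForm_single_self (M : CoxeterMatrix B) (i : B) :
    corootForm M i (Finsupp.single i 1) = 2 := by
  simp [corootForm_single]

/-- The simple reflection `v ↦ v - 2⟨α_i, v⟩ α_i` of the geometric representation. -/
noncomputable def geomReflection (M : CoxeterMatrix B) (i : B) : (B →₀ ℝ) ≃ₗ[ℝ] (B →₀ ℝ) :=
  Module.reflection (corootForm_single_self M i)

theorem geomReflection_apply (M : CoxeterMatrix B) (i : B) (v : B →₀ ℝ) :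
    geomReflection M i v = v - corootForm M i v • Finsupp.single i 1 := by
  simp [geomReflection, Module.reflection_apply]

theorem geomReflection_mul_self (M : CoxeterMatrix B) (i : B) :
    geomReflection M i * geomReflection M i = 1 := by
  ext1 v
  exact Module.involutive_reflection (corootForm_single_self M i) v

theorem geomReflection_isLiftable (M : CoxeterMatrix B) : M.IsLiftable (geomReflection M) := by
  intro i j
  have hsymm : corootForm M j (Finsupp.single i 1) = corootForm M i (Finsupp.single j 1) := by
    simp [corootForm_single, M.symmetric j i]
  have hf := corootForm_single M i j
  obtain hm | hm | hm | hm : M i j = 0 ∨ M i j = 1 ∨ M i j = 2 ∨ 3 ≤ M i j := by omega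
  · simp [hm]
  · obtain rfl : i = j := by
      by_contra hne
      exact M.off_diagonal i j hne hm
    simp [geomReflection_mul_self]
  · have hz : corootForm M i (Finsupp.single j 1) = 0 := by simp [hf, hm]
    rw [hz] at hsymm
    rw [hm]
    ext1 v
    simp only [pow_two, LinearEquiv.mul_apply, geomReflection_apply, map_sub, map_smul, hz, hsymm,
      corootForm_single_self, LinearEquiv.coe_one, id_eq]
    module
  · have hm0 : (0 : ℝ) < M i j := by positivity
    have hm3 : (3 : ℝ) ≤ M i j := by exact_mod_cast hm
    set θ : ℝ := 2 * (Real.pi / M i j) with hθ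
    have hsin : Real.sin θ ≠ 0 := by
      apply ne_of_gt
      apply Real.sin_pos_of_pos_of_lt_pi
      · positivity
      · rw [hθ, ← mul_div_assoc, div_lt_iff₀ hm0]
        nlinarith [Real.pi_pos]
    have ht : 2 * Real.cos θ = corootForm M i (Finsupp.single j 1) *
        corootForm M j (Finsupp.single i 1) - 2 := by
      rw [hsymm, hf, hθ, Real.cos_two_mul]
      ring
    have hS (n : ℤ) := Polynomial.Chebyshev.S_two_mul_real_cos θ n
    apply LinearEquiv.toLinearMap_injective
    rw [geomReflection, geomReflection, Module.reflection_mul_reflection_pow _ _ (M i j) _ ht]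
    obtain ⟨p, hp | hp⟩ := Nat.even_or_odd' (M i j)
    · have hpθ : (p : ℝ) * θ = Real.pi := by
        rw [hθ, hp]
        have : (p : ℝ) ≠ 0 := by
          rintro h0
          simp_all
        push_cast
        field_simp
      have h0 : ((Polynomial.Chebyshev.S ℝ ((p : ℤ) - 1)).eval (2 * Real.cos θ)) = 0 := by
        have := hS (p - 1)
        push_cast at this
        rw [sub_add_cancel, hpθ, Real.sin_pi] at this
        exact (mul_eq_zero.mp this).resolve_right hsin
      have e1 : ((M i j : ℤ) - 2) / 2 = p - 1 := by omega
      have e2 : ((M i j : ℤ) - 1) / 2 = p - 1 := by omega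
      rw [e1, e2, h0]
      simp
    · have hpθ : ((p : ℝ) + 1) * θ = 2 * Real.pi - p * θ := by
        have : (M i j : ℝ) * θ = 2 * Real.pi := by
          rw [hθ]
          field_simp
        rw [hp] at this
        push_cast at this
        linear_combination this
      have h0 : (Polynomial.Chebyshev.S ℝ (p : ℤ)).eval (2 * Real.cos θ) +
          (Polynomial.Chebyshev.S ℝ ((p : ℤ) - 1)).eval (2 * Real.cos θ) = 0 := by
        have h1 := hS p
        have h2 := hS (p - 1)
        push_cast at h1 h2
        rw [hpθ, Real.sin_two_pi_sub] at h1
        rw [sub_add_cancel] at h2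
        exact (mul_eq_zero.mp (by linear_combination h1 + h2 :
          (_ + _) * Real.sin θ = 0)).resolve_right hsin
      have e1 : ((M i j : ℤ) - 2) / 2 = p - 1 := by omega
      have e2 : ((M i j : ℤ) - 1) / 2 = p := by omega
      have e3 : ((M i j : ℤ) - 3) / 2 = p - 1 := by omega
      have e4 : (M i j : ℤ) / 2 = p := by omega
      rw [e1, e2, e3, e4, h0]
      simp

theorem simple_injective (cs : CoxeterSystem M W) : Function.Injective cs.simple := by
  intro i j hij
  by_contra hne
  have h := congrArg (cs.lift ⟨_, geomReflection_isLiftable M⟩) hij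
  rw [cs.lift_apply_simple, cs.lift_apply_simple] at h
  have h2 := DFunLike.congr_fun (DFunLike.congr_fun h (Finsupp.single i 1)) i
  rw [geomReflection_apply, geomReflection_apply, corootForm_single_self] at h2
  simp [Ne.symm hne] at h2

theorem eq_two_of_commute (cs : CoxeterSystem M W) {i j : B} (hne : i ≠ j)
    (hc : cs.simple i * cs.simple j = cs.simple j * cs.simple i) : M i j = 2 := by
  have h := congrArg (cs.lift ⟨_, geomReflection_isLiftable M⟩) hc
  rw [map_mul, map_mul, cs.lift_apply_simple, cs.lift_apply_simple] at h
  have h2 := DFunLike.congr_fun (DFunLike.congr_fun h (Finsupp.single j 1)) i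
  simp only [LinearEquiv.mul_apply, geomReflection_apply, map_sub, map_smul,
    corootForm_single_self] at h2
  simp [hne, corootForm_single] at h2
  have h3 : Real.cos (Real.pi / M i j) = 0 := by linarith
  by_contra hm2
  obtain hm | hm | hm : M i j = 0 ∨ M i j = 1 ∨ 3 ≤ M i j := by omega
  · simp [hm] at h3
  · exact M.off_diagonal i j hne hm
  · have hm3 : (3 : ℝ) ≤ M i j := by exact_mod_cast hm
    have hlt : Real.pi / M i j < Real.pi / 2 := by
      apply div_lt_div_of_pos_left Real.pi_pos <;> linarith
    have hpos : 0 < Real.pi / M i j := by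
      have := Real.pi_pos
      positivity
    exact (Real.cos_pos_of_mem_Ioo ⟨by linarith, hlt⟩).ne' h3

open Classical in
/-- The action of a simple reflection on pairs (element, sign), which records inversions. -/
noncomputable def signedConj (cs : CoxeterSystem M W) (i : B) : Function.End (W × ZMod 2) :=
  fun x => (cs.simple i * x.1 * cs.simple i, x.2 + if x.1 = cs.simple i then 1 else 0)

open Classical in
theorem signedConj_mul_pow_apply (cs : CoxeterSystem M W) (i j : B) (n : ℕ) (t : W)
    (e : ZMod 2) :
    ((signedConj cs i * signedConj cs j) ^ n) (t, e) =
      ((cs.simple i * cs.simple j) ^ n * t * ((cs.simple i * cs.simple j) ^ n)⁻¹,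
        e + ∑ k ∈ Finset.range (2 * n),
          if t = cs.simple j * (cs.simple i * cs.simple j) ^ k then 1 else 0) := by
  induction n with
  | zero => simp; rfl
  | succ n ih =>
    set r := cs.simple i * cs.simple j with hr
    have hconj : ∀ k : ℕ, (cs.simple j) * r ^ k = (r ^ k)⁻¹ * cs.simple j := by
      intro k
      induction k with
      | zero => simp
      | succ k ihk =>
        rw [pow_succ, ← mul_assoc, ihk, ← pow_succ, pow_succ', mul_inv_rev, hr, mul_inv_rev]
        simp [mul_assoc]
    have e1 : r ^ n * t * (r ^ n)⁻¹ = cs.simple j ↔ t = cs.simple j * r ^ (2 * n) := by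
      rw [two_mul, pow_add, ← mul_assoc, hconj, mul_inv_eq_iff_eq_mul, mul_assoc,
        eq_inv_mul_iff_mul_eq]
    have e2 : cs.simple j * (r ^ n * t * (r ^ n)⁻¹) * cs.simple j = cs.simple i ↔
        t = cs.simple j * r ^ (2 * n + 1) := by
      have h1 : cs.simple j * r ^ (2 * n + 1) =
          (r ^ n)⁻¹ * (cs.simple j * cs.simple i * cs.simple j) * r ^ n := by
        rw [two_mul, add_assoc, pow_add, ← mul_assoc, hconj, pow_succ', hr]
        simp only [mul_assoc]
      rw [h1]
      constructor
      · intro h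
        rw [← h]
        simp [mul_assoc]
      · rintro rfl
        simp [mul_assoc]
    have hstep : ((signedConj cs i * signedConj cs j) ^ (n + 1)) (t, e) =
        signedConj cs i (signedConj cs j (((signedConj cs i * signedConj cs j) ^ n) (t, e))) := by
      rw [pow_succ']
      rfl
    rw [hstep, ih, mul_add, mul_one, Finset.sum_range_succ, Finset.sum_range_succ]
    simp only [signedConj, e1, e2]
    rw [pow_succ' r n, mul_inv_rev, hr, mul_inv_rev]
    simp only [mul_assoc, add_assoc, CoxeterSystem.inv_simple]

theorem signedConj_isLiftable (cs : CoxeterSystem M W) : M.IsLiftable (signedConj cs) := by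
  classical
  intro i j
  funext ⟨t, e⟩
  rw [signedConj_mul_pow_apply, cs.simple_mul_simple_pow, two_mul, Finset.sum_range_add]
  simp only [pow_add, cs.simple_mul_simple_pow, one_mul, CharTwo.add_self_eq_zero]
  simp
  rfl

/-- The action of `W` on pairs (element, sign) extending `signedConj`. -/
noncomputable def signedAction (cs : CoxeterSystem M W) : W →* Function.End (W × ZMod 2) :=
  cs.lift ⟨signedConj cs, signedConj_isLiftable cs⟩

open Classical in
theorem signedAction_wordProd_apply (cs : CoxeterSystem M W) (ω : List B) (t : W) (e : ZMod 2) :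
    signedAction cs (cs.wordProd ω) (t, e) =
      (cs.wordProd ω * t * (cs.wordProd ω)⁻¹, e + ((cs.rightInvSeq ω).count t : ZMod 2)) := by
  induction ω with
  | nil => simp; rfl
  | cons i ω ih =>
    have hstep : signedAction cs (cs.wordProd (i :: ω)) (t, e) =
        signedConj cs i (signedAction cs (cs.wordProd ω) (t, e)) := by
      rw [cs.wordProd_cons, map_mul]
      simp only [signedAction]
      rw [cs.lift_apply_simple]
      rfl
    have e1 : cs.wordProd ω * t * (cs.wordProd ω)⁻¹ = cs.simple i ↔
        (cs.wordProd ω)⁻¹ * cs.simple i * cs.wordProd ω = t := by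
      constructor
      · intro h
        rw [← h]
        group
      · rintro rfl
        group
    rw [hstep, ih]
    simp only [signedConj, CoxeterSystem.rightInvSeq, List.count_cons, e1, cs.wordProd_cons,
      mul_inv_rev, cs.inv_simple, beq_iff_eq]
    push_cast
    simp only [mul_assoc, add_assoc]

/-- The exchange property. -/
theorem exists_sublist_of_isRightDescent (cs : CoxeterSystem M W) (ω : List B) {j : B}
    (h : cs.IsRightDescent (cs.wordProd ω) j) :
    ∃ ω' : List B, ω'.Sublist ω ∧ ω'.length + 1 = ω.length ∧
      cs.wordProd ω * cs.simple j = cs.wordProd ω' := by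
  classical
  suffices hmem : cs.simple j ∈ cs.rightInvSeq ω by
    obtain ⟨p, hp, hpj⟩ := List.mem_iff_getElem.mp hmem
    have hp' : p < ω.length := by simpa using hp
    refine ⟨ω.eraseIdx p, List.eraseIdx_sublist ω p, List.length_eraseIdx_add_one hp', ?_⟩
    rw [← cs.wordProd_mul_getD_rightInvSeq, List.getD_eq_getElem _ 1 hp, hpj]
  by_contra hmem
  obtain ⟨ω', hred, hω'⟩ := cs.exists_isReduced (cs.wordProd ω * cs.simple j)
  have key : signedAction cs (cs.wordProd ω') (cs.simple j, 0) =
      signedAction cs (cs.wordProd ω) (cs.simple j, 1) := by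
    have : signedAction cs (cs.wordProd ω') (cs.simple j, 0) =
        signedAction cs (cs.wordProd ω) (signedConj cs j (cs.simple j, 0)) := by
      rw [← hω', map_mul]
      simp only [signedAction]
      rw [cs.lift_apply_simple]
      rfl
    rw [this]
    simp [signedConj]
  rw [signedAction_wordProd_apply, signedAction_wordProd_apply, List.count_eq_zero.mpr hmem] at key
  have hcount := congrArg Prod.snd key
  simp only [zero_add, Nat.cast_zero, add_zero] at hcount
  have hmem' : cs.simple j ∈ cs.rightInvSeq ω' := by
    by_contra hn
    rw [List.count_eq_zero.mpr hn] at hcount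
    simp at hcount
  have := (cs.isRightInversion_of_mem_rightInvSeq hred hmem').2
  rw [← hω', cs.simple_mul_simple_cancel_right] at this
  exact lt_asymm h this

theorem exists_sublist_of_isLeftDescent (cs : CoxeterSystem M W) (ω : List B) {i : B}
    (h : cs.IsLeftDescent (cs.wordProd ω) i) :
    ∃ ω' : List B, ω'.Sublist ω ∧ ω'.length + 1 = ω.length ∧
      cs.simple i * cs.wordProd ω = cs.wordProd ω' := by
  rw [← cs.isRightDescent_inv_iff, ← cs.wordProd_reverse] at h
  obtain ⟨ω', hsub, hlen, heq⟩ := exists_sublist_of_isRightDescent cs _ h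
  refine ⟨ω'.reverse, by simpa using hsub.reverse, by simpa using hlen, ?_⟩
  rw [cs.wordProd_reverse, ← heq, cs.wordProd_reverse]
  simp

/-- The standard parabolic subgroup generated by the simple reflections indexed by `I`. -/
def parabolic (cs : CoxeterSystem M W) (I : Set B) : Subgroup W :=
  Subgroup.closure (cs.simple '' I)

theorem simple_mem_parabolic (cs : CoxeterSystem M W) {I : Set B} {i : B} (hi : i ∈ I) :
    cs.simple i ∈ parabolic cs I :=
  Subgroup.subset_closure ⟨i, hi, rfl⟩

theorem wordProd_mem_parabolic (cs : CoxeterSystem M W) {I : Set B} {ω : List B}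
    (h : ∀ x ∈ ω, x ∈ I) : cs.wordProd ω ∈ parabolic cs I := by
  apply Subgroup.list_prod_mem
  simp only [List.mem_map, forall_exists_index, and_imp]
  rintro _ x hx rfl
  exact simple_mem_parabolic cs (h x hx)

theorem exists_word_of_mem_parabolic (cs : CoxeterSystem M W) {I : Set B} {d : W}
    (hd : d ∈ parabolic cs I) : ∃ ω : List B, (∀ x ∈ ω, x ∈ I) ∧ cs.wordProd ω = d := by
  induction hd using Subgroup.closure_induction with
  | mem x hx =>
    obtain ⟨i, hi, rfl⟩ := hx
    exact ⟨[i], by simpa using hi, by simp⟩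
  | one => exact ⟨[], by simp, by simp⟩
  | mul x y _ _ ihx ihy =>
    obtain ⟨α, hα, rfl⟩ := ihx
    obtain ⟨β, hβ, rfl⟩ := ihy
    refine ⟨α ++ β, ?_, cs.wordProd_append α β⟩
    intro z hz
    rcases List.mem_append.mp hz with hz | hz
    exacts [hα z hz, hβ z hz]
  | inv x _ ih =>
    obtain ⟨α, hα, rfl⟩ := ih
    exact ⟨α.reverse, by simpa using hα, cs.wordProd_reverse α⟩

theorem exists_length_minimal_in_coset (cs : CoxeterSystem M W) (I : Set B) (w : W) :
    ∃ d ∈ parabolic cs I, ∀ d' ∈ parabolic cs I, cs.length (d * w) ≤ cs.length (d' * w) := by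
  classical
  have hex : ∃ n, ∃ d ∈ parabolic cs I, cs.length (d * w) = n := ⟨_, 1, one_mem _, rfl⟩
  obtain ⟨d, hd, hlen⟩ := Nat.find_spec hex
  exact ⟨d, hd, fun d' hd' => hlen.trans_le (Nat.find_min' hex ⟨d', hd', rfl⟩)⟩

theorem eq_one_of_length_minimal (cs : CoxeterSystem M W) {I : Set B} {v d : W}
    (hv : ∀ d' ∈ parabolic cs I, cs.length v ≤ cs.length (d' * v)) (hd : d ∈ parabolic cs I)
    (hdesc : ∀ i ∈ I, ¬ cs.IsLeftDescent (d * v) i) : d = 1 := by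
  classical
  have hex : ∃ n, ∃ ω : List B, (∀ x ∈ ω, x ∈ I) ∧ cs.wordProd ω = d ∧ ω.length = n := by
    obtain ⟨ω, hω, hd⟩ := exists_word_of_mem_parabolic cs hd
    exact ⟨_, ω, hω, hd, rfl⟩
  obtain ⟨ω, hω, hωd, hlen⟩ := Nat.find_spec hex
  have hmin : ∀ ω' : List B, (∀ x ∈ ω', x ∈ I) → cs.wordProd ω' = d → ω.length ≤ ω'.length :=
    fun ω' h1 h2 => hlen.trans_le (Nat.find_min' hex ⟨ω', h1, h2, rfl⟩)
  cases ω with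
  | nil => simpa using hωd.symm
  | cons i ω =>
    exfalso
    have hω' : ∀ x ∈ ω, x ∈ I := fun x hx => hω x (List.mem_cons_of_mem i hx)
    obtain ⟨β, hβ, rfl⟩ := cs.exists_isReduced v
    have hdv : cs.simple i * cs.wordProd (ω ++ β) = d * cs.wordProd β := by
      rw [← hωd, cs.wordProd_append, cs.wordProd_cons, mul_assoc]
    have hleft : cs.IsLeftDescent (cs.wordProd (ω ++ β)) i := by
      rw [cs.isLeftDescent_iff_not_isLeftDescent_mul, hdv]
      exact hdesc i (hω i List.mem_cons_self)
    obtain ⟨γ, hsub, hγlen, hγ⟩ := exists_sublist_of_isLeftDescent cs _ hleft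
    obtain ⟨α', β', rfl, hα', hβ'⟩ := List.sublist_append_iff.mp hsub
    rw [hdv, cs.wordProd_append] at hγ
    simp only [List.length_append] at hγlen
    by_cases hlenβ : β'.length = β.length
    · obtain rfl := hβ'.eq_of_length hlenβ
      have := hmin α' (fun x hx => hω' x (hα'.subset hx)) (mul_right_cancel hγ).symm
      simp only [List.length_cons] at this
      omega
    · have hle := hβ'.length_le
      have hle' := hα'.length_le
      obtain rfl := hα'.eq_of_length (by omega)
      have hmem : (cs.wordProd α')⁻¹ * d ∈ parabolic cs I :=
        mul_mem (inv_mem (wordProd_mem_parabolic cs hω')) hd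
      have h1 := hv _ hmem
      rw [mul_assoc, hγ, inv_mul_cancel_left, hβ.eq] at h1
      have h2 := cs.length_wordProd_le β'
      omega

theorem length_le_of_no_leftDescent (cs : CoxeterSystem M W) {I : Set B} {u d : W}
    (hu : ∀ i ∈ I, ¬ cs.IsLeftDescent u i) (hd : d ∈ parabolic cs I) :
    cs.length u ≤ cs.length (d * u) := by
  obtain ⟨c, hc, hmin⟩ := exists_length_minimal_in_coset cs I u
  have h1 : c⁻¹ = 1 := by
    apply eq_one_of_length_minimal cs (v := c * u) _ (inv_mem hc) (by simpa using hu)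
    intro d' hd'
    rw [← mul_assoc]
    exact hmin _ (mul_mem hd' hc)
  rw [inv_eq_one] at h1
  subst h1
  simpa using hmin d hd

theorem eq_one_of_no_leftDescent (cs : CoxeterSystem M W) {I : Set B} {u d : W}
    (hd : d ∈ parabolic cs I) (hu : ∀ i ∈ I, ¬ cs.IsLeftDescent u i)
    (hdu : ∀ i ∈ I, ¬ cs.IsLeftDescent (d * u) i) : d = 1 :=
  eq_one_of_length_minimal cs (fun _ h => length_le_of_no_leftDescent cs hu h) hd hdu

theorem isRightDescent_or_eq_simple_mul (cs : CoxeterSystem M W) {I : Set B} {u d : W} {j : B}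
    (hd : d ∈ parabolic cs I) (hu : ∀ i ∈ I, ¬ cs.IsLeftDescent u i)
    (hj : cs.IsRightDescent (d * u) j) :
    cs.IsRightDescent u j ∨ ∃ e ∈ I, u * cs.simple j = cs.simple e * u := by
  rw [or_iff_not_imp_left]
  intro huj
  have huj' := cs.not_isRightDescent_iff.mp huj
  have ht : u * cs.simple j * u⁻¹ ∈ parabolic cs I := by
    obtain ⟨α, hα, rfl⟩ := exists_word_of_mem_parabolic cs hd
    obtain ⟨β, hβ, rfl⟩ := cs.exists_isReduced u
    rw [← cs.wordProd_append] at hj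
    obtain ⟨γ, hsub, hlen, hγ⟩ := exists_sublist_of_isRightDescent cs _ hj
    obtain ⟨α', β', rfl, hα', hβ'⟩ := List.sublist_append_iff.mp hsub
    rw [cs.wordProd_append, cs.wordProd_append, mul_assoc] at hγ
    simp only [List.length_append] at hlen
    by_cases hlenβ : β'.length = β.length
    · obtain rfl := hβ'.eq_of_length hlenβ
      rw [← eq_inv_mul_iff_mul_eq, ← mul_assoc] at hγ
      rw [hγ, mul_inv_cancel_right]
      exact mul_mem (inv_mem (wordProd_mem_parabolic cs hα))
        (wordProd_mem_parabolic cs fun x hx => hα x (hα'.subset hx))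
    · have hle := hβ'.length_le
      have hle' := hα'.length_le
      obtain rfl := hα'.eq_of_length (by omega)
      exfalso
      apply huj
      rw [CoxeterSystem.IsRightDescent, mul_left_cancel hγ, hβ.eq]
      have h2 := cs.length_wordProd_le β'
      omega
  have hex : ∃ e ∈ I, cs.IsLeftDescent (u * cs.simple j) e := by
    by_contra! hno
    have h1 := eq_one_of_no_leftDescent cs ht hu (by simpa using hno)
    rw [mul_inv_eq_one] at h1
    rw [h1] at huj'
    omega
  obtain ⟨e, he, hdesc⟩ := hex
  refine ⟨e, he, ?_⟩
  have hlen := cs.isLeftDescent_iff.mp hdesc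
  have hmem : cs.simple e * (u * cs.simple j * u⁻¹) ∈ parabolic cs I :=
    mul_mem (simple_mem_parabolic cs he) ht
  have hrw : cs.simple e * (u * cs.simple j * u⁻¹) * u = cs.simple e * (u * cs.simple j) := by
    simp [mul_assoc]
  have h1 := eq_one_of_no_leftDescent cs hmem hu (by
    intro i hi hdi
    rw [hrw, CoxeterSystem.IsLeftDescent] at hdi
    have h2 := length_le_of_no_leftDescent cs hu (mul_mem (simple_mem_parabolic cs hi) hmem)
    rw [mul_assoc, hrw] at h2
    omega)
  rw [h1, one_mul] at hrw
  nth_rw 2 [hrw]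
  simp

theorem mem_of_mem_altWord {a b x : B} {n : ℕ} (h : x ∈ altWord a b n) :
    x ∈ ({a, b} : Set B) := by
  induction n generalizing a b with
  | zero => simp [altWord] at h
  | succ n ih =>
    rw [altWord, List.mem_cons] at h
    rcases h with rfl | h
    · simp
    · rw [Set.pair_comm]
      exact ih h

theorem length_altWord (a b : B) (n : ℕ) : (altWord a b n).length = n := by
  induction n generalizing a b with
  | zero => rfl
  | succ n ih => simp [altWord, ih]

theorem exists_altWord_succ_eq_append (a b : B) (n : ℕ) :
    ∃ c c', ({c, c'} : Set B) = {a, b} ∧ altWord a b (n + 1) = altWord a b n ++ [c] ∧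
      altWord b a (n + 1) = altWord b a n ++ [c'] := by
  induction n generalizing a b with
  | zero => exact ⟨a, b, rfl, rfl, rfl⟩
  | succ n ih =>
    obtain ⟨c, c', h, h1, h2⟩ := ih a b
    refine ⟨c', c, (Set.pair_comm c' c).trans h, ?_, ?_⟩
    · rw [altWord, h2]
      rfl
    · rw [altWord, h1]
      rfl

theorem exists_eq_altWord_mul (cs : CoxeterSystem M W) (v : W) (a b : B)
    (hb : ¬ cs.IsLeftDescent v b) :
    ∃ n u, v = cs.wordProd (altWord a b n) * u ∧ cs.length v = n + cs.length u ∧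
      ∀ i ∈ ({a, b} : Set B), ¬ cs.IsLeftDescent u i := by
  induction hn : cs.length v using Nat.strong_induction_on generalizing v a b with
  | _ n ih =>
    by_cases ha : cs.IsLeftDescent v a
    · have hlen := cs.isLeftDescent_iff.mp ha
      obtain ⟨m, u, h1, h2, h3⟩ := ih (cs.length (cs.simple a * v)) (by omega)
        (cs.simple a * v) b a (cs.isLeftDescent_iff_not_isLeftDescent_mul.mp ha) rfl
      refine ⟨m + 1, u, ?_, by omega, by rwa [Set.pair_comm]⟩
      rw [altWord, cs.wordProd_cons, mul_assoc, ← h1, cs.simple_mul_simple_cancel_left]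
    · exact ⟨0, v, by simp [altWord], by simp [hn], by simp [ha, hb]⟩

/-- Structure of an element `y` with two distinct left descents `i` and `k`: it is `w₀(i, k) u` with
`u` of minimal length in its coset, where `w₀(i, k) = x s_c = s_i x`. -/
theorem exists_dihedral_factorization (cs : CoxeterSystem M W) {y : W} {i k : B} (hik : i ≠ k)
    (hi : cs.IsLeftDescent y i) (hk : cs.IsLeftDescent y k) :
    ∃ (x u : W) (c c' : B), y = x * (cs.simple c * u) ∧ x * cs.simple c = cs.simple i * x ∧
      c ≠ c' ∧ ({c, c'} : Set B) = {i, k} ∧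
      x * cs.simple c * cs.simple c' = cs.simple k * (x * cs.simple c) ∧
      cs.length y = cs.length x + 1 + cs.length u ∧
      cs.length (x * cs.simple c) = cs.length x + 1 ∧
      cs.length (cs.simple c * u) = cs.length u + 1 ∧
      cs.IsLeftDescent x k ∧ x ∈ parabolic cs {i, k} ∧
      ∀ e ∈ ({i, k} : Set B), ¬ cs.IsLeftDescent u e := by
  obtain ⟨n, u, hy1, hl1, hu⟩ := exists_eq_altWord_mul cs (cs.simple k * y) i k
    (cs.isLeftDescent_iff_not_isLeftDescent_mul.mp hk)
  obtain ⟨n', u', hy2, hl2, hu'⟩ := exists_eq_altWord_mul cs (cs.simple i * y) k i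
    (cs.isLeftDescent_iff_not_isLeftDescent_mul.mp hi)
  rw [cs.isLeftDescent_iff] at hi hk
  have hP (n : ℕ) : cs.wordProd (altWord i k n) ∈ parabolic cs {i, k} :=
    wordProd_mem_parabolic cs fun _ => mem_of_mem_altWord
  have hP' (n : ℕ) : cs.wordProd (altWord k i n) ∈ parabolic cs {i, k} :=
    wordProd_mem_parabolic cs fun _ h => Set.pair_comm k i ▸ mem_of_mem_altWord h
  replace hy1 : y = cs.wordProd (altWord k i (n + 1)) * u := by
    rw [altWord, cs.wordProd_cons, mul_assoc, ← hy1, cs.simple_mul_simple_cancel_left]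
  replace hy2 : y = cs.wordProd (altWord i k (n' + 1)) * u' := by
    rw [altWord, cs.wordProd_cons, mul_assoc, ← hy2, cs.simple_mul_simple_cancel_left]
  have hd := eq_one_of_no_leftDescent cs (mul_mem (inv_mem (hP (n' + 1))) (hP' (n + 1))) hu (by
    rwa [mul_assoc, ← hy1, hy2, inv_mul_cancel_left, Set.pair_comm])
  rw [inv_mul_eq_one] at hd
  obtain rfl : u' = u := by
    rw [hy1, hd] at hy2
    exact (mul_left_cancel hy2).symm
  obtain rfl : n' = n := by omega
  obtain ⟨c, c', hcc, hc, hc'⟩ := exists_altWord_succ_eq_append k i n'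
  rw [Set.pair_comm k i] at hcc
  set x := cs.wordProd (altWord k i n') with hx
  set x' := cs.wordProd (altWord i k n') with hx'
  have e1 : cs.wordProd (altWord k i (n' + 1)) = x * cs.simple c := by
    rw [hc, cs.wordProd_append, cs.wordProd_singleton]
  have e2 : cs.wordProd (altWord i k (n' + 1)) = x' * cs.simple c' := by
    rw [hc', cs.wordProd_append, cs.wordProd_singleton]
  have e3 : cs.wordProd (altWord i k (n' + 1)) = cs.simple i * x := by
    rw [altWord, cs.wordProd_cons]
  have e4 : cs.wordProd (altWord k i (n' + 1)) = cs.simple k * x' := by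
    rw [altWord, cs.wordProd_cons]
  have hne : c ≠ c' := by
    rintro rfl
    apply hik
    have h1 : i ∈ ({c, c} : Set B) := by rw [hcc]; simp
    have h2 : k ∈ ({c, c} : Set B) := by rw [hcc]; simp
    simp only [Set.mem_insert_iff, Set.mem_singleton_iff, or_self] at h1 h2
    rw [h1, h2]
  have hxle : cs.length x ≤ n' := (cs.length_wordProd_le _).trans_eq (length_altWord k i n')
  have hxc := cs.length_mul_le (x * cs.simple c) u'
  rw [← e1, ← hy1, e1] at hxc
  have hxc' := cs.length_mul_simple x c
  have hcmem : c ∈ ({i, k} : Set B) := hcc ▸ Set.mem_insert c {c'}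
  refine ⟨x, u', c, c', ?_, ?_, hne, hcc, ?_, by omega, by omega,
    cs.not_isLeftDescent_iff.mp (hu c hcmem), ?_, hP' n', hu⟩
  · rw [hy1, e1, mul_assoc]
  · rw [← e1, ← hd, e3]
  · rw [← e1, ← hd, e2, cs.simple_mul_simple_cancel_right, ← e2, hd, e4,
      cs.simple_mul_simple_cancel_left]
  · cases n' with
    | zero =>
      exfalso
      have h1 : altWord k i 1 = [k] := rfl
      have h2 : altWord i k 1 = [i] := rfl
      rw [zero_add, h1, h2, cs.wordProd_singleton, cs.wordProd_singleton] at hd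
      exact hik (simple_injective cs hd)
    | succ m =>
      rw [CoxeterSystem.IsLeftDescent]
      have h1 : cs.simple k * x = cs.wordProd (altWord i k m) := by
        rw [hx, altWord, cs.wordProd_cons, cs.simple_mul_simple_cancel_left]
      have h2 := cs.length_wordProd_le (altWord i k m)
      rw [length_altWord] at h2
      rw [h1]
      omega

theorem isRightDescent_mul_of_length_add (cs : CoxeterSystem M W) {z u : W} {d : B}
    (hlen : cs.length (z * u) = cs.length z + cs.length u) (hd : cs.IsRightDescent u d) :
    cs.IsRightDescent (z * u) d := by
  have h := cs.length_mul_le z (u * cs.simple d)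
  rw [CoxeterSystem.IsRightDescent] at hd ⊢
  rw [mul_assoc]
  omega

theorem InGamma.isLeftDescent {cs : CoxeterSystem M W} {w : W} {i j : B}
    (h : InGamma cs (w, i, j)) : cs.IsLeftDescent w i := by
  simp only [InGamma] at h
  have h1 := cs.length_mul_simple (cs.simple i * w) j
  rw [CoxeterSystem.IsLeftDescent]
  omega

theorem InGamma.isRightDescent {cs : CoxeterSystem M W} {w : W} {i j : B}
    (h : InGamma cs (w, i, j)) : cs.IsRightDescent w j := by
  simp only [InGamma] at h
  have h1 := cs.length_simple_mul (w * cs.simple j) i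
  rw [← mul_assoc] at h1
  rw [CoxeterSystem.IsRightDescent]
  omega

/-- Given a second left descent `k ≠ i` of `y`, the triple `(y, i, j)` reduces unless
`y s_j = s_k y`. -/
theorem exists_redL_of_isLeftDescent (cs : CoxeterSystem M W) {y : W} {i j k : B}
    (h : InGamma cs (y, i, j)) (hik : i ≠ k) (hk : cs.IsLeftDescent y k) :
    (y * cs.simple j = cs.simple k * y ∧ ∃ d, d ≠ j ∧ cs.IsRightDescent y d) ∨
    ∃ x u c, y = x * u ∧ cs.length (x * u) = cs.length x + cs.length u ∧
      cs.IsLeftDescent x k ∧ (cs.length x = 1 → M k i = 2) ∧ RedL cs (y, i, j) (u, c, j) := by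
  obtain ⟨x, u, c, c', hy, hxc, hne, hcc, hxc', hly, hlxc, hlcu, hxk, hxP, hu⟩ :=
    exists_dihedral_factorization cs hik h.isLeftDescent hk
  have hcmem : c ∈ ({i, k} : Set B) := hcc ▸ Set.mem_insert c {c'}
  by_cases huj : cs.IsRightDescent u j
  · right
    refine ⟨x, cs.simple c * u, c, hy, by rw [← hy]; omega, hxk, ?_, h, ?_, ?_, rfl, ?_, ?_⟩
    · intro hx1
      obtain rfl : x = cs.simple k := by
        rw [CoxeterSystem.IsLeftDescent, hx1, Nat.lt_one_iff, cs.length_eq_zero_iff] at hxk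
        rw [← cs.simple_mul_simple_cancel_left (w := x) k, hxk, mul_one]
      rcases hcmem with rfl | rfl
      · exact eq_two_of_commute cs hik.symm hxc
      · simp only [cs.simple_mul_simple_self, cs.length_one] at hlxc
        omega
    · simp only [InGamma, cs.simple_mul_simple_cancel_left]
      have := cs.isRightDescent_iff.mp huj
      omega
    · simp only [WeakLeftLE]
      rw [hy, mul_inv_cancel_right, ← hy]
      omega
    · simp only
      rw [hy, mul_inv_cancel_right, hxc, mul_inv_cancel_right]
    · simp only
      rw [hy, mul_inv_cancel_right, hlxc]
  · left
    have hyd : y = x * cs.simple c * u := by rw [hy, mul_assoc]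
    constructor
    · have hmem := mul_mem hxP (simple_mem_parabolic cs hcmem)
      obtain ⟨e, he, hue⟩ := (isRightDescent_or_eq_simple_mul cs hmem hu
        (hyd ▸ h.isRightDescent)).resolve_left huj
      rw [← hcc] at he
      rcases he with rfl | rfl
      · exfalso
        have hg : cs.simple i * y * cs.simple j = y := by
          rw [mul_assoc, hyd, mul_assoc _ u, hue]
          simp only [← mul_assoc]
          rw [← hxc]
          simp
        simp only [InGamma, hg] at h
        omega
      · rw [hyd, mul_assoc _ u, hue, ← mul_assoc, hxc', mul_assoc]
    · by_cases hu1 : u = 1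
      · subst hu1
        rw [mul_one] at hyd
        subst hyd
        by_cases hcj : c = j
        · refine ⟨c', fun h => hne (hcj.trans h.symm), ?_⟩
          rw [CoxeterSystem.IsRightDescent, hxc']
          exact hk
        · refine ⟨c, hcj, ?_⟩
          rw [CoxeterSystem.IsRightDescent, cs.simple_mul_simple_cancel_right]
          omega
      · obtain ⟨d, hd⟩ := cs.exists_rightDescent_of_ne_one hu1
        refine ⟨d, fun hdj => huj (hdj ▸ hd), ?_⟩
        rw [hyd]
        exact isRightDescent_mul_of_length_add cs (by rw [← hyd]; omega) hd

theorem exists_bigrassmannian_red (cs : CoxeterSystem M W) {w : W} {i j : B}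
    (h : InGamma cs (w, i, j)) (hj : ∀ d, cs.IsRightDescent w d → d = j) :
    ∃ v r, InGamma cs (v, r, j) ∧ Bigrassmannian cs v ∧ Red cs (w, i, j) (v, r, j) ∧
      cs.length v ≤ cs.length w := by
  induction hn : cs.length w using Nat.strong_induction_on generalizing w i with
  | _ n ih =>
    by_cases hex : ∃ k, i ≠ k ∧ cs.IsLeftDescent w k
    · obtain ⟨k, hik, hk⟩ := hex
      rcases exists_redL_of_isLeftDescent cs h hik hk with
        ⟨-, d, hdj, hd⟩ | ⟨x, u, c, rfl, hlen, hxk, -, hred⟩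
      · exact absurd (hj d hd) hdj
      · rw [CoxeterSystem.IsLeftDescent] at hxk
        obtain ⟨v, r, h1, h2, h3, h4⟩ := ih (cs.length u) (by omega) hred.2.1
          (fun d hd => hj d (isRightDescent_mul_of_length_add cs hlen hd)) rfl
        exact ⟨v, r, h1, h2, h3.head (Or.inl hred), by omega⟩
    · refine ⟨w, i, h, ⟨⟨i, h.isLeftDescent, fun k hk => ?_⟩, ⟨j, h.isRightDescent, hj⟩⟩,
        Relation.ReflTransGen.refl, hn.le⟩
      by_contra hki
      exact hex ⟨k, Ne.symm hki, hk⟩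

theorem exists_shorter_of_mapsSimple (cs : CoxeterSystem M W) {w : W} {i j a b : B}
    (h : InGamma cs (w, i, j)) (hj : ∀ d, cs.IsRightDescent w d → d = j) (haj : M a j = 2)
    (hab : MapsSimple cs w a b) (hbi : M b i ≠ 2) :
    ∃ v r s, InGamma cs (v, r, s) ∧ Bigrassmannian cs v ∧ EquivRed cs (w, i, j) (v, r, s) ∧
      cs.length v < cs.length w := by
  obtain ⟨hconj, hlen⟩ := hab
  rw [mul_inv_eq_iff_eq_mul] at hconj
  have hane : a ≠ j := by
    rintro rfl
    simp at haj
  have hcomm : cs.simple a * cs.simple j = cs.simple j * cs.simple a := by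
    have h1 := cs.simple_mul_simple_pow a j
    rw [haj, pow_two, mul_eq_one_iff_eq_inv] at h1
    simpa using h1
  have haj1 : cs.simple a * cs.simple j ≠ 1 := by
    rw [Ne, mul_eq_one_iff_eq_inv, cs.inv_simple]
    exact fun h => hane (simple_injective cs h)
  have hbi' : i ≠ b := by
    rintro rfl
    have h1 := h.isLeftDescent
    rw [CoxeterSystem.IsLeftDescent, ← hconj] at h1
    omega
  have hy : InGamma cs (w * cs.simple a, i, j) := by
    simp only [InGamma] at h ⊢
    have e : cs.simple i * (w * cs.simple a) * cs.simple j =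
        cs.simple i * w * cs.simple j * cs.simple a := by
      simp only [mul_assoc, hcomm]
    have h1 := cs.length_mul_simple (cs.simple i * w * cs.simple j) a
    have h2 := cs.length_mul_simple (cs.simple i * (w * cs.simple a)) j
    have h3 := cs.length_simple_mul (w * cs.simple a) i
    rw [e] at h2 ⊢
    omega
  have hyw : RedR cs (w * cs.simple a, i, j) (w, i, j) := by
    refine ⟨hy, h, ?_, rfl, ?_, ?_⟩
    · simp only [WeakRightLE, inv_mul_cancel_left, cs.length_simple, hlen]
    · simp only [inv_mul_cancel_left]
      rw [hcomm, mul_inv_cancel_right]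
    · simp only [inv_mul_cancel_left, cs.length_simple]
      have h1 := cs.length_mul_simple (cs.simple a) j
      rw [cs.length_simple] at h1
      have h2 := mt cs.length_eq_zero_iff.mp haj1
      omega
  have hyb : cs.IsLeftDescent (w * cs.simple a) b := by
    rw [CoxeterSystem.IsLeftDescent, hlen, hconj, cs.simple_mul_simple_cancel_left]
    omega
  rcases exists_redL_of_isLeftDescent cs hy hbi' hyb with
    ⟨hbad, -⟩ | ⟨x, u, c, hxu, hlxu, hxb, hx1, hred⟩
  · exfalso
    rw [hconj, cs.simple_mul_simple_cancel_left, ← hconj, mul_assoc] at hbad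
    exact haj1 (mul_eq_left.mp hbad)
  · rw [cs.isLeftDescent_iff] at hxb
    have hx1' := mt hx1 hbi
    have hw : w = cs.simple b * x * u := by
      rw [mul_assoc, ← hxu, hconj, cs.simple_mul_simple_cancel_left]
    rw [← hxu] at hlxu
    obtain ⟨v, r, h1, h2, h3, h4⟩ := exists_bigrassmannian_red cs hred.2.1 (by
      intro d hd
      apply hj
      rw [hw]
      exact isRightDescent_mul_of_length_add cs (by rw [← hw]; omega) hd)
    refine ⟨v, r, j, h1, h2, ?_, by omega⟩
    have hup : Red cs (w * cs.simple a, i, j) (w, i, j) :=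
      Relation.ReflTransGen.single (Or.inr hyw)
    have hdown : Red cs (w * cs.simple a, i, j) (v, r, j) :=
      Relation.ReflTransGen.head (Or.inl hred) h3
    exact ((Relation.EqvGen.rel _ _ hup).symm).trans _ _ _ (Relation.EqvGen.rel _ _ hdown)

theorem InGamma.inv {cs : CoxeterSystem M W} {w : W} {i j : B}
    (h : InGamma cs (w, i, j)) : InGamma cs (w⁻¹, j, i) := by
  simp only [InGamma] at h ⊢
  rw [← cs.length_inv, cs.length_inv w, ← h]
  simp [mul_assoc]

theorem Bigrassmannian.inv {cs : CoxeterSystem M W} {w : W} (h : Bigrassmannian cs w) :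
    Bigrassmannian cs w⁻¹ := by
  simpa only [Bigrassmannian, cs.isLeftDescent_inv_iff, cs.isRightDescent_inv_iff] using h.symm

theorem MapsSimple.inv {cs : CoxeterSystem M W} {v : W} {a b : B} (h : MapsSimple cs v a b) :
    MapsSimple cs v⁻¹ b a := by
  obtain ⟨h1, h2⟩ := h
  refine ⟨by rw [← h1]; group, ?_⟩
  rw [← h1, ← cs.length_inv, cs.length_inv v, ← h2]
  simp [mul_assoc]

theorem RedL.inv {cs : CoxeterSystem M W} {w u : W} {i j i' j' : B}
    (h : RedL cs (w, i, j) (u, i', j')) : RedR cs (w⁻¹, j, i) (u⁻¹, j', i') := by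
  obtain ⟨h1, h2, h3, h4, h5⟩ := h
  refine ⟨h1.inv, h2.inv, ?_, h4, by simpa using h5.inv⟩
  simp only [WeakLeftLE, WeakRightLE] at h3 ⊢
  rw [cs.length_inv, cs.length_inv, ← h3, ← cs.length_inv (w * u⁻¹), mul_inv_rev]

theorem RedR.inv {cs : CoxeterSystem M W} {w u : W} {i j i' j' : B}
    (h : RedR cs (w, i, j) (u, i', j')) : RedL cs (w⁻¹, j, i) (u⁻¹, j', i') := by
  obtain ⟨h1, h2, h3, h4, h5⟩ := h
  refine ⟨h1.inv, h2.inv, ?_, h4, by simpa using h5.inv⟩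
  simp only [WeakLeftLE, WeakRightLE] at h3 ⊢
  rw [cs.length_inv, cs.length_inv, ← h3, ← cs.length_inv (u⁻¹ * w), mul_inv_rev]

theorem EquivRed.inv {cs : CoxeterSystem M W} {w u : W} {i j i' j' : B}
    (h : EquivRed cs (w, i, j) (u, i', j')) : EquivRed cs (w⁻¹, j, i) (u⁻¹, j', i') := by
  let φ : W × B × B → W × B × B := fun x => (x.1⁻¹, x.2.2, x.2.1)
  suffices key : ∀ x y, EquivRed cs x y → EquivRed cs (φ x) (φ y) from key _ _ h
  intro x y hxy
  induction hxy with
  | rel x y hr =>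
    refine Relation.EqvGen.rel _ _ (Relation.ReflTransGen.lift φ ?_ x y hr)
    rintro ⟨w, i, j⟩ ⟨u, i', j'⟩ (hL | hR)
    exacts [Or.inr hL.inv, Or.inl hR.inv]
  | refl x => exact Relation.EqvGen.refl _
  | symm x y _ ih => exact ih.symm
  | trans x y z _ _ ih1 ih2 => exact ih1.trans _ _ _ ih2

theorem exists_shorter_of_not_orthCond (cs : CoxeterSystem M W) {w : W} {i j : B}
    (h : InGamma cs (w, i, j)) (hbg : Bigrassmannian cs w) (hno : ¬ OrthCond cs w i j) :
    ∃ v r s, InGamma cs (v, r, s) ∧ Bigrassmannian cs v ∧ EquivRed cs (w, i, j) (v, r, s) ∧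
      cs.length v < cs.length w := by
  rw [OrthCond, not_and_or] at hno
  push Not at hno
  rcases hno with ⟨a, b, haj, hab, hbi⟩ | ⟨a, b, hai, hab, hbj⟩
  · exact exists_shorter_of_mapsSimple cs h (fun d hd => hbg.2.unique hd h.isRightDescent)
      haj hab hbi
  · obtain ⟨v, r, s, h1, h2, h3, h4⟩ := exists_shorter_of_mapsSimple cs h.inv
      (fun d hd => hbg.inv.2.unique hd h.inv.isRightDescent) hai hab hbj
    refine ⟨v⁻¹, s, r, h1.inv, h2.inv, by simpa using h3.inv, ?_⟩
    rwa [cs.length_inv, ← cs.length_inv w]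

/-- Every `(w, i, j) ∈ Γ(W)` with `w` bigrassmannian is equivalent to some `(v, r, s) ∈ Γ(W)`
with `v` bigrassmannian and satisfying the orthogonality condition. -/
theorem reduce_to_orthogonal_bigrassmannian [Finite W] (cs : CoxeterSystem M W) (w : W) (i j : B)
    (h : InGamma cs (w, i, j)) (hbg : Bigrassmannian cs w) :
    ∃ (v : W) (r s : B), InGamma cs (v, r, s) ∧ Bigrassmannian cs v ∧ OrthCond cs v r s ∧
      EquivRed cs (w, i, j) (v, r, s) := by
  induction hn : cs.length w using Nat.strong_induction_on generalizing w i j with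
  | _ n ih =>
    by_cases ho : OrthCond cs w i j
    · exact ⟨w, i, j, h, hbg, ho, Relation.EqvGen.refl _⟩
    · obtain ⟨u, k, l, h1, h2, h3, h4⟩ := exists_shorter_of_not_orthCond cs h hbg ho
      obtain ⟨v, r, s, g1, g2, g3, g4⟩ := ih (cs.length u) (hn ▸ h4) u k l h1 h2 rfl
      exact ⟨v, r, s, g1, g2, g3, h3.trans _ _ _ g4⟩

end NilpotencyIndices
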